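/- Let G = ⟨s₁,…,s_r⟩ be the free group of rank r and let (T,X,μ,α) be a G-process with H(α) < ∞. Let β be a partition of X with H(β) < ∞ such that β^G ⊂ α^G. Then f_*(T,α|β^G) = f(T,α|β^G). -/

import Mathlib

open MeasureTheory Filter
open scoped ENNReal symmDiff

namespace Bowen

noncomputable section

/-- The free group of rank `r`. -/
abbrev FG (r : ℕ) := FreeGroup (Fin r)

/-- The generating set element corresponding to `(i, b)`: `sᵢ` if `b = true`,
`sᵢ⁻¹` if `b = false`. -/
def gen {r : ℕ} (s : Fin r × Bool) : FG r :=
  cond s.2 (FreeGroup.of s.1) (FreeGroup.of s.1)⁻¹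

/-- The symmetric generating set `S = {s₁^{±1},…,s_r^{±1}}`. -/
def Sset (r : ℕ) : Set (FG r) := Set.range (gen (r := r))

/-- The ball of radius `n` about the identity in the word metric of `(G,S)`. -/
def ball (r n : ℕ) : Set (FG r) := {g | FreeGroup.norm g ≤ n}

section Partitions

variable {X : Type*} [mX : MeasurableSpace X] {K L : Type*}

/-- Shannon entropy of the countable labeled partition `p` with respect to `μ`
(in `ℝ≥0∞`, so that `H(p) < ∞` is meaningful). -/
def Hpart (μ : Measure X) (p : X → K) : ℝ≥0∞ :=
  ∑' k : K, ENNReal.ofReal (Real.negMulLog ((μ (p ⁻¹' {k})).toReal))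

/-- The atom of the partition `p` containing `x`. -/
def atomOf (p : X → K) (x : X) : Set X := p ⁻¹' {p x}

/-- Conditional Shannon entropy of `p` given the sub-σ-algebra `m`:
`H(p|m) = ∫ -log( μ(A_x | m)(x) ) dμ(x)`. -/
def HpartC (μ : Measure X) (p : X → K) (m : MeasurableSpace X) : ℝ≥0∞ :=
  ∫⁻ x, ENNReal.ofReal
    (- Real.log ((μ[(atomOf p x).indicator (fun _ => (1:ℝ)) | m]) x)) ∂μ

/-- Join of two labeled partitions. -/
def pjoin (p : X → K) (q : X → L) : X → K × L := fun x => (p x, q x)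

/-- Pullback partition `T_g^{-1} p`. -/
def pull {r : ℕ} (T : FG r → X → X) (g : FG r) (p : X → K) : X → K :=
  fun x => p (T g x)

/-- The join `⋁_{q ∈ Q} T_q^{-1} p` over a set `Q ⊆ G`. -/
def powS {r : ℕ} (T : FG r → X → X) (p : X → K) (Q : Set (FG r)) : X → (Q → K) :=
  fun x q => p (T (q : FG r) x)

/-- The join `p^n = ⋁_{g ∈ B(e,n)} T_g^{-1} p`. -/
def pow {r : ℕ} (T : FG r → X → X) (p : X → K) (n : ℕ) : X → (ball r n → K) :=
  powS T p (ball r n)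

/-- The σ-algebra generated by the partition `p`. -/
def sAlg (p : X → K) : MeasurableSpace X := MeasurableSpace.comap p ⊤

/-- The smallest `G`-invariant σ-algebra containing the partition `p`. -/
def sAlgG {r : ℕ} (T : FG r → X → X) (p : X → K) : MeasurableSpace X :=
  ⨆ g : FG r, sAlg (pull T g p)

/-- The σ-algebra `⋁_{f ∈ Q} T_f^{-1} p` for a (possibly infinite) `Q ⊆ G`. -/
def sAlgSet {r : ℕ} (T : FG r → X → X) (p : X → K) (Q : Set (FG r)) :
    MeasurableSpace X :=
  ⨆ f ∈ Q, sAlg (pull T f p)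

/-- `F(T,α) = (1−2r)H(α) + ∑ᵢ H(α ∨ T_{sᵢ}^{-1}α)`. -/
def FF {r : ℕ} (T : FG r → X → X) (μ : Measure X) (p : X → K) : ℝ :=
  (1 - 2 * (r : ℝ)) * (Hpart μ p).toReal
    + ∑ i : Fin r, (Hpart μ (pjoin p (pull T (FreeGroup.of i) p))).toReal

/-- `f(T,α) = inf_{n>0} F(T,α^n)`, as an extended real. -/
def littleF {r : ℕ} (T : FG r → X → X) (μ : Measure X) (p : X → K) : EReal :=
  ⨅ n : ℕ, ((FF T μ (pow T p (n + 1)) : ℝ) : EReal)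

/-- Conditional version `F(T,α|𝓕) = (1−2r)H(α|𝓕) + ∑ᵢ H(α ∨ T_{sᵢ}^{-1}α|𝓕)`. -/
def FFc {r : ℕ} (T : FG r → X → X) (μ : Measure X) (m : MeasurableSpace X)
    (p : X → K) : ℝ :=
  (1 - 2 * (r : ℝ)) * (HpartC (mX := mX) μ p m).toReal
    + ∑ i : Fin r, (HpartC (mX := mX) μ (pjoin p (pull T (FreeGroup.of i) p)) m).toReal

/-- Conditional `f(T,α|𝓕) = inf_{n>0} F(T,α^n|𝓕)`. -/
def littleFc {r : ℕ} (T : FG r → X → X) (μ : Measure X) (m : MeasurableSpace X)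
    (p : X → K) : EReal :=
  ⨅ n : ℕ, ((FFc (mX := mX) T μ m (pow T p (n + 1)) : ℝ) : EReal)

/-- The mean entropy `h(T_s, α) = lim_n H(⋁_{i=0}^n T_s^{-i}α)/(n+1)`; since the
sequence is subadditive the limit equals the infimum, which we take as the
definition. -/
def hrate {r : ℕ} (T : FG r → X → X) (μ : Measure X) (s : FG r) (p : X → K) : ℝ :=
  ⨅ n : ℕ, (Hpart μ (fun x (i : Fin (n + 1)) => p (T (s ^ (i : ℕ)) x))).toReal / (n + 1)

/-- Conditional mean entropy `h(T_s, α|𝓕) = lim_n H(⋁_{i=0}^n T_s^{-i}α | 𝓕)/(n+1)`;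
for an invariant `𝓕` the sequence is subadditive so the limit equals the infimum. -/
def hrateC {r : ℕ} (T : FG r → X → X) (μ : Measure X) (m : MeasurableSpace X)
    (s : FG r) (p : X → K) : ℝ :=
  ⨅ n : ℕ, (HpartC (mX := mX) μ (fun x (i : Fin (n + 1)) => p (T (s ^ (i : ℕ)) x)) m).toReal / (n + 1)

/-- `F_*(T,α) = (1−r)H(α) + ∑ᵢ h(T_{sᵢ},α)`. -/
def Fstar {r : ℕ} (T : FG r → X → X) (μ : Measure X) (p : X → K) : ℝ :=
  (1 - (r : ℝ)) * (Hpart μ p).toReal + ∑ i : Fin r, hrate T μ (FreeGroup.of i) p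

/-- `f_*(T,α) = inf_{n>0} F_*(T,α^n)`. -/
def fstar {r : ℕ} (T : FG r → X → X) (μ : Measure X) (p : X → K) : EReal :=
  ⨅ n : ℕ, ((Fstar T μ (pow T p (n + 1)) : ℝ) : EReal)

/-- `F_*(T,α|𝓕) = (1−r)H(α|𝓕) + ∑ᵢ h(T_{sᵢ},α|𝓕)`. -/
def FstarC {r : ℕ} (T : FG r → X → X) (μ : Measure X) (m : MeasurableSpace X)
    (p : X → K) : ℝ :=
  (1 - (r : ℝ)) * (HpartC (mX := mX) μ p m).toReal + ∑ i : Fin r, hrateC (mX := mX) T μ m (FreeGroup.of i) p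

/-- `f_*(T,α|𝓕) = inf_{n>0} F_*(T,α^n|𝓕)`. -/
def fstarC {r : ℕ} (T : FG r → X → X) (μ : Measure X) (m : MeasurableSpace X)
    (p : X → K) : EReal :=
  ⨅ n : ℕ, ((FstarC (mX := mX) T μ m (pow T p (n + 1)) : ℝ) : EReal)

/-- `p` refines `q`: each atom of `p` is contained, up to a `μ`-null set,
in an atom of `q`. -/
def Refines (μ : Measure X) (p : X → K) (q : X → L) : Prop :=
  ∀ k : K, ∃ l : L, μ (p ⁻¹' {k} \ q ⁻¹' {l}) = 0

/-- Two labeled partitions are equal as partitions (up to null sets). -/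
def PartEquiv (μ : Measure X) (p : X → K) (q : X → L) : Prop :=
  Refines μ p q ∧ Refines μ q p

/-- `σ` is a simple splitting of `p`: `σ = p ∨ T_s^{-1}β` for some `s ∈ S` and
some coarsening `β` of `p`. -/
def SimpleSplit {r : ℕ} (μ : Measure X) (T : FG r → X → X) (p σ : X → ℕ) : Prop :=
  ∃ s ∈ Sset r, ∃ β : X → ℕ, Measurable β ∧ Refines μ p β ∧
    PartEquiv μ σ (pjoin p (pull T s β))

/-- `τ` is a splitting of `p`: obtained from `p` by a finite sequence of simple
splittings (as a partition, i.e. up to relabeling and null sets). -/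
def IsSplitting {r : ℕ} (μ : Measure X) (T : FG r → X → X) (p : X → ℕ)
    (τ : X → K) : Prop :=
  ∃ σ : X → ℕ, Relation.ReflTransGen (SimpleSplit μ T) p σ ∧ PartEquiv μ σ τ

/-- A partition is generating if the smallest `G`-invariant σ-algebra containing it
is the full σ-algebra up to `μ`-null sets. -/
def Generating {r : ℕ} (T : FG r → X → X) (μ : Measure X) (p : X → K) : Prop :=
  ∀ A : Set X, MeasurableSet A →
    ∃ A' : Set X, MeasurableSet[sAlgG T p] A' ∧ μ (A ∆ A') = 0

/-- The Rohlin distance `d(α,β) = H(α|β) + H(β|α)`. -/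
def rohlinDist (μ : Measure X) (p : X → K) (q : X → L) : ℝ :=
  (HpartC μ p (sAlg q)).toReal + (HpartC μ q (sAlg p)).toReal

end Partitions

/-- Adjacency in the left Cayley graph `Γ_L`: an edge joins `a` and `sa`, `s ∈ S`. -/
def adjL {r : ℕ} (a b : FG r) : Prop := ∃ s ∈ Sset r, b = s * a

/-- `Past(g₁;g₂)`: the set of `f ∈ G` such that every path in the left Cayley
graph from `f` to `g₁` passes through `g₂`. -/
def Past {r : ℕ} (g₁ g₂ : FG r) : Set (FG r) :=
  {f | ∀ l : List (FG r), l ≠ [] → l.head? = some f → l.getLast? = some g₁ →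
        l.Chain' adjL → g₂ ∈ l}

/-- A subset `F ⊆ G` is right-connected: the subgraph of the right Cayley graph
induced on `F` is connected. -/
def RightConnected {r : ℕ} (F : Set (FG r)) : Prop :=
  ∀ g ∈ F, ∀ h ∈ F,
    Relation.ReflTransGen (fun a b => a ∈ F ∧ b ∈ F ∧ ∃ s ∈ Sset r, b = a * s) g h

/-- A subset `F ⊆ G` is left-connected: the subgraph of the left Cayley graph
induced on `F` is connected. -/
def LeftConnected {r : ℕ} (F : Set (FG r)) : Prop :=
  ∀ g ∈ F, ∀ h ∈ F,
    Relation.ReflTransGen (fun a b => a ∈ F ∧ b ∈ F ∧ ∃ s ∈ Sset r, b = s * a) g h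

section Markov

variable {X : Type*} [MeasurableSpace X] {K : Type*}

/-- A `G`-process `(T,X,μ,α)` is Markov: for every `s ∈ S`, `g ∈ G` and every atom
`A` of `α`, `μ(T_{sg}^{-1}A | ⋁_{f∈Past(sg;g)} T_f^{-1}α) = μ(T_{sg}^{-1}A | T_g^{-1}α)`
almost everywhere. -/
def IsMarkov {r : ℕ} (μ : Measure X) (T : FG r → X → X) (p : X → K) : Prop :=
  ∀ s ∈ Sset r, ∀ g : FG r, ∀ k : K,
    (μ[((pull T (s * g) p) ⁻¹' {k}).indicator (fun _ => (1:ℝ)) |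
        sAlgSet T p (Past (s * g) g)])
      =ᵐ[μ]
    (μ[((pull T (s * g) p) ⁻¹' {k}).indicator (fun _ => (1:ℝ)) |
        sAlg (pull T g p)])

end Markov


section ExtraDefs

/-- The distance `d₁` between two ordered processes:
`∑_{s∈S} ∑_{i,j} |μ(A_i ∩ T_s^{-1}A_j) − ν(B_i ∩ U_s^{-1}B_j)|`. -/
def d1 {X Y : Type*} [MeasurableSpace X] [MeasurableSpace Y] {r : ℕ}
    (T : FG r → X → X) (μ : Measure X) (α : X → ℕ)
    (U : FG r → Y → Y) (ν : Measure Y) (β : Y → ℕ) : ℝ :=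
  ∑ i : Fin r, ∑ b : Bool,
    ∑' ij : ℕ × ℕ,
      |(μ (α ⁻¹' {ij.1} ∩ pull T (gen (i, b)) α ⁻¹' {ij.2})).toReal -
        (ν (β ⁻¹' {ij.1} ∩ pull U (gen (i, b)) β ⁻¹' {ij.2})).toReal|

/-- Isomorphism of ordered processes: a measure conjugacy between conull sets
intertwining the actions and carrying the `i`-th atom to the `i`-th atom. -/
def OrderedIso {X Y : Type*} [MeasurableSpace X] [MeasurableSpace Y] {r : ℕ}
    (T : FG r → X → X) (μ : Measure X) (α : X → ℕ)
    (U : FG r → Y → Y) (ν : Measure Y) (β : Y → ℕ) : Prop :=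
  ∃ (X' : Set X) (Y' : Set Y) (φ : X → Y) (ψ : Y → X),
    MeasurableSet X' ∧ MeasurableSet Y' ∧ μ X'ᶜ = 0 ∧ ν Y'ᶜ = 0 ∧
    Measurable φ ∧ Measurable ψ ∧ Set.MapsTo φ X' Y' ∧ Set.MapsTo ψ Y' X' ∧
    (∀ x ∈ X', ψ (φ x) = x) ∧ (∀ y ∈ Y', φ (ψ y) = y) ∧
    Measure.map φ μ = ν ∧
    (∀ (g : FG r), ∀ x ∈ X', φ (T g x) = U g (φ x)) ∧
    (∀ x ∈ X', β (φ x) = α x)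

/-- A transition system for `(G,S)`: a family of `K × K` matrices indexed by the
generating set together with a row vector, written as functions. -/
structure TransSys (r : ℕ) (K : Type*) where
  P : Fin r × Bool → K → K → ℝ
  pi : K → ℝ

/-- The transition system is an invariant transition system: the `P^s` are
stochastic matrices, `π` is a probability vector which is a steady state vector
for every `P^s`, and `π_i P^{s^{-1}}_{ij} = π_j P^s_{ji}`. -/
def TransSys.IsInvariant {r : ℕ} {K : Type*} (ts : TransSys r K) : Prop :=
  (∀ s i j, 0 ≤ ts.P s i j) ∧ (∀ s i, HasSum (ts.P s i) 1) ∧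
    (∀ i, 0 ≤ ts.pi i) ∧ HasSum ts.pi 1 ∧
    (∀ s j, HasSum (fun i => ts.pi i * ts.P s i j) (ts.pi j)) ∧
    (∀ s i j, ts.pi i * ts.P (s.1, !s.2) i j = ts.pi j * ts.P s j i)

/-- The canonical (shift) action of `G` on `K^G`: `(T_g x)(f) = x(fg)`. -/
def shiftT {r : ℕ} {K : Type*} : FG r → (FG r → K) → (FG r → K) :=
  fun g x f => x (f * g)

/-- `μ` is (a measure) induced by the transition system `ts`: the time-`e`
distribution is `π` and the transition probabilities into the complement of the
past are given by the matrices `P^s`.  (Note `T_g^{-1}A_k = {x : x(g) = k}`;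
the conditional equalities `μ(A|B) = c` are recorded in the equivalent product
form `μ(A ∩ B) = c·μ(B)`.) -/
def IsInducedBy {r : ℕ} {K : Type*} [MeasurableSpace K]
    (μ : Measure (FG r → K)) (ts : TransSys r K) : Prop :=
  (∀ k : K, μ {x | x 1 = k} = ENNReal.ofReal (ts.pi k)) ∧
  ∀ (s : Fin r × Bool) (g : FG r),
    FreeGroup.norm (gen s * g) = FreeGroup.norm g + 1 →
    ∀ (n : ℕ) (fs : Fin n → FG r) (ks : Fin n → K) (k₀ k : K),
      (∀ i, fs i ∈ Past (gen s * g) g ∧ fs i ≠ g) →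
      (μ ({x | x (gen s * g) = k} ∩ ({x | x g = k₀} ∩ ⋂ i, {x | x (fs i) = ks i}))
          = ENNReal.ofReal (ts.P s k₀ k) * μ ({x | x g = k₀} ∩ ⋂ i, {x | x (fs i) = ks i})) ∧
      μ ({x | x (gen s * g) = k} ∩ {x | x g = k₀})
          = ENNReal.ofReal (ts.P s k₀ k) * μ {x | x g = k₀}

end ExtraDefs


section Comb

variable {r : ℕ}

/-- Right translate of a finite set. -/
def rt (A : Finset (FG r)) (g : FG r) : Finset (FG r) := A.image (fun a => a * g)

/-- The union of the translates `A s^j`, `0 ≤ j ≤ m`. -/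
def seg (A : Finset (FG r)) (s : FG r) (m : ℕ) : Finset (FG r) :=
  (Finset.range (m + 1)).biUnion (fun j => rt A (s ^ j))

/-- Abstract version of `F`. -/
def absF (h : Finset (FG r) → ℝ) (A : Finset (FG r)) : ℝ :=
  (1 - 2 * (r : ℝ)) * h A + ∑ i : Fin r, h (A ∪ rt A (FreeGroup.of i))

/-- Abstract version of `F_*`. -/
def absFs (h : Finset (FG r) → ℝ) (A : Finset (FG r)) : ℝ :=
  (1 - (r : ℝ)) * h A + ∑ i : Fin r, ⨅ n : ℕ, h (seg A (FreeGroup.of i) n) / (n + 1)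

lemma mem_rt {A : Finset (FG r)} {g x : FG r} : x ∈ rt A g ↔ ∃ a ∈ A, a * g = x :=
  Finset.mem_image

lemma mem_seg {A : Finset (FG r)} {s x : FG r} {m : ℕ} :
    x ∈ seg A s m ↔ ∃ j ≤ m, ∃ a ∈ A, a * s ^ j = x := by
  simp only [seg, Finset.mem_biUnion, Finset.mem_range, mem_rt, Nat.lt_succ_iff]

lemma seg_zero (A : Finset (FG r)) (s : FG r) : seg A s 0 = A := by
  ext x; simp [mem_seg]

lemma seg_mono (A : Finset (FG r)) (s : FG r) {m n : ℕ} (hmn : m ≤ n) :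
    seg A s m ⊆ seg A s n := by
  intro x hx
  rw [mem_seg] at hx ⊢
  obtain ⟨j, hj, a, ha, rfl⟩ := hx
  exact ⟨j, hj.trans hmn, a, ha, rfl⟩

lemma rt_seg_subset (A : Finset (FG r)) (s : FG r) (m : ℕ) :
    rt (seg A s m) s ⊆ seg A s (m + 1) := by
  intro x hx
  obtain ⟨y, hy, rfl⟩ := mem_rt.1 hx
  obtain ⟨j, hj, a, ha, rfl⟩ := mem_seg.1 hy
  exact mem_seg.2 ⟨j + 1, by omega, a, ha, by rw [pow_succ, mul_assoc]⟩

lemma seg_succ (A : Finset (FG r)) (s : FG r) (m : ℕ) :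
    seg A s (m + 1) = seg A s m ∪ rt (seg A s m) s := by
  apply Finset.Subset.antisymm
  · intro x hx
    obtain ⟨j, hj, a, ha, rfl⟩ := mem_seg.1 hx
    rw [Finset.mem_union]
    rcases j with _ | j
    · exact Or.inl (mem_seg.2 ⟨0, by omega, a, ha, rfl⟩)
    · refine Or.inr (mem_rt.2 ⟨a * s ^ j, mem_seg.2 ⟨j, by omega, a, ha, rfl⟩, ?_⟩)
      rw [pow_succ, mul_assoc]
  · exact Finset.union_subset (seg_mono A s (by omega)) (rt_seg_subset A s m)

lemma rt_mono {A B : Finset (FG r)} (hAB : A ⊆ B) (g : FG r) : rt A g ⊆ rt B g :=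
  Finset.image_subset_image hAB

/-- Entropy-like set function. -/
structure EntLike (h : Finset (FG r) → ℝ) : Prop where
  nonneg : ∀ A, 0 ≤ h A
  mono : ∀ A B, A ⊆ B → h A ≤ h B
  sub : ∀ A B C, C ⊆ A → C ⊆ B → h (A ∪ B) + h C ≤ h A + h B
  inv : ∀ A g, h (rt A g) = h A
  empty : h ∅ = 0

variable {h : Finset (FG r) → ℝ}

lemma EntLike.seg_concave (hh : EntLike h) (A : Finset (FG r)) (s : FG r) (m : ℕ) :
    h (seg A s (m + 2)) - h (seg A s (m + 1)) ≤ h (seg A s (m + 1)) - h (seg A s m) := by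
  have h1 := hh.sub (seg A s (m + 1)) (rt (seg A s (m + 1)) s) (rt (seg A s m) s)
    (rt_seg_subset A s m) (rt_mono (seg_mono A s (by omega)) s)
  rw [← seg_succ, hh.inv, hh.inv] at h1
  have : m + 1 + 1 = m + 2 := rfl
  rw [this] at h1
  linarith

lemma EntLike.seg_one (hh : EntLike h) (A : Finset (FG r)) (s : FG r) :
    h (seg A s 1) - h (seg A s 0) ≤ h A := by
  have h1 := hh.sub (seg A s 0) (rt (seg A s 0) s) ∅ (by simp) (by simp)
  rw [← seg_succ, hh.inv, hh.empty, seg_zero] at h1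
  rw [seg_zero]
  simp only [zero_add] at h1
  linarith

lemma EntLike.seg_diff_le (hh : EntLike h) (A : Finset (FG r)) (s : FG r) (m : ℕ) :
    (m + 1 : ℝ) * (h (seg A s (m + 1)) - h (seg A s m)) ≤ h (seg A s m) := by
  induction m with
  | zero => simpa [seg_zero] using hh.seg_one A s
  | succ m ih =>
    have h1 := hh.seg_concave A s m
    have h2 : (m + 1 + 1 : ℝ) * (h (seg A s (m + 2)) - h (seg A s (m + 1)))
      ≤ (m + 1 + 1 : ℝ) * (h (seg A s (m + 1)) - h (seg A s m)) :=
      mul_le_mul_of_nonneg_left h1 (by positivity)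
    push_cast
    have : m + 1 + 1 = m + 2 := rfl
    rw [this]
    linarith

lemma EntLike.seg_le (hh : EntLike h) (A : Finset (FG r)) (s : FG r) (m : ℕ) :
    h (seg A s (m + 1)) - h (seg A s m) ≤ h (seg A s 1) - h A ∧
    h (seg A s m) ≤ h A + m * (h (seg A s 1) - h A) := by
  induction m with
  | zero => simp [seg_zero]
  | succ m ih =>
    have h1 := hh.seg_concave A s m
    have : m + 1 + 1 = m + 2 := rfl
    rw [this]
    push_cast
    constructor
    · linarith [ih.1]
    · linarith [ih.1, ih.2]

lemma EntLike.bdd (hh : EntLike h) (A : Finset (FG r)) (s : FG r) :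
    BddBelow (Set.range (fun n : ℕ => h (seg A s n) / (n + 1))) :=
  ⟨0, by rintro _ ⟨n, rfl⟩; have := hh.nonneg (seg A s n); positivity⟩

lemma EntLike.rate_le (hh : EntLike h) (A : Finset (FG r)) (s : FG r) :
    ⨅ n : ℕ, h (seg A s n) / (n + 1) ≤ h (A ∪ rt A s) - h A := by
  have e1 : A ∪ rt A s = seg A s 1 := by rw [seg_succ, seg_zero]
  rw [e1]
  have lim : Tendsto (fun n : ℕ => (h (seg A s 1) - h A) +
      (2 * h A - h (seg A s 1)) * (1 / ((n : ℝ) + 1))) atTop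
      (nhds ((h (seg A s 1) - h A) + (2 * h A - h (seg A s 1)) * 0)) :=
    tendsto_const_nhds.add (tendsto_const_nhds.mul tendsto_one_div_add_atTop_nhds_zero_nat)
  rw [mul_zero, add_zero] at lim
  refine ge_of_tendsto' lim (fun n => (ciInf_le (hh.bdd A s) n).trans ?_)
  have := (hh.seg_le A s n).2
  rw [div_le_iff₀ (by positivity)]
  have hn : (n : ℝ) + 1 ≠ 0 := by positivity
  field_simp
  linarith

lemma EntLike.absFs_le (hh : EntLike h) (A : Finset (FG r)) : absFs h A ≤ absF h A := by
  unfold absFs absF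
  have : ∑ i : Fin r, ⨅ n : ℕ, h (seg A (FreeGroup.of i) n) / (n + 1) ≤
      ∑ i : Fin r, (h (A ∪ rt A (FreeGroup.of i)) - h A) :=
    Finset.sum_le_sum (fun i _ => hh.rate_le A _)
  rw [Finset.sum_sub_distrib] at this
  simp at this
  linarith

/-- The star-shaped set with arms of lengths `m i`. -/
def star (A : Finset (FG r)) (m : Fin r → ℕ) : Finset (FG r) :=
  Finset.univ.biUnion (fun i => seg A (FreeGroup.of i) (m i))

lemma EntLike.star_le (hh : EntLike h) (A : Finset (FG r)) (m : Fin r → ℕ)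
    (S : Finset (Fin r)) :
    h (A ∪ S.biUnion (fun i => seg A (FreeGroup.of i) (m i))) ≤
      h A + ∑ i ∈ S, (h (seg A (FreeGroup.of i) (m i)) - h A) := by
  classical
  induction S using Finset.induction_on with
  | empty => simp
  | insert i S hi ih =>
    rw [Finset.sum_insert hi, Finset.biUnion_insert]
    have h1 := hh.sub (A ∪ S.biUnion (fun i => seg A (FreeGroup.of i) (m i)))
      (seg A (FreeGroup.of i) (m i)) A Finset.subset_union_left
      (by
        have := seg_mono A (FreeGroup.of i) (Nat.zero_le (m i))
        rwa [seg_zero] at this)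
    have e : A ∪ (seg A (FreeGroup.of i) (m i) ∪ S.biUnion (fun i => seg A (FreeGroup.of i) (m i)))
        = (A ∪ S.biUnion (fun i => seg A (FreeGroup.of i) (m i))) ∪
          seg A (FreeGroup.of i) (m i) := by
      ext x; simp only [Finset.mem_union]; tauto
    rw [e]
    linarith

lemma subset_star (hr : 1 ≤ r) (A : Finset (FG r)) (m : Fin r → ℕ) : A ⊆ star A m := by
  have := seg_mono A (FreeGroup.of (⟨0, hr⟩ : Fin r)) (Nat.zero_le (m ⟨0, hr⟩))
  rw [seg_zero] at this
  exact this.trans (Finset.subset_biUnion_of_mem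
    (fun i => seg A (FreeGroup.of i) (m i)) (Finset.mem_univ _))

lemma EntLike.absF_star (hh : EntLike h) (hr : 1 ≤ r) (A : Finset (FG r)) (m : Fin r → ℕ) :
    absF h (star A m) ≤ (1 - (r : ℝ)) * h A +
      ∑ i : Fin r, (h (seg A (FreeGroup.of i) (m i + 1)) - h (seg A (FreeGroup.of i) (m i))) := by
  set Q := star A m with hQ
  have key : ∀ i : Fin r, h (Q ∪ rt Q (FreeGroup.of i)) ≤
      2 * h Q + (h (seg A (FreeGroup.of i) (m i + 1)) - h (seg A (FreeGroup.of i) (m i)))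
        - h (seg A (FreeGroup.of i) (m i)) := by
    intro i
    set s : FG r := FreeGroup.of i
    have harm : seg A s (m i) ⊆ Q := Finset.subset_biUnion_of_mem
      (fun i => seg A (FreeGroup.of i) (m i)) (Finset.mem_univ i)
    have h1 := hh.sub Q (seg A s (m i + 1)) (seg A s (m i)) harm (seg_mono A s (by omega))
    have h2 := hh.sub (Q ∪ seg A s (m i + 1)) (rt Q s) (rt (seg A s (m i)) s)
      ((rt_seg_subset A s (m i)).trans Finset.subset_union_right) (rt_mono harm s)
    rw [hh.inv, hh.inv] at h2
    have h3 := hh.mono (Q ∪ rt Q s) (Q ∪ seg A s (m i + 1) ∪ rt Q s)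
      (Finset.union_subset_union_left Finset.subset_union_left)
    linarith
  have h4 : h Q ≤ h A + ∑ i, (h (seg A (FreeGroup.of i) (m i)) - h A) := by
    have := hh.star_le A m Finset.univ
    exact (hh.mono _ _ Finset.subset_union_right).trans this
  have h5 := Finset.sum_le_sum (fun i (_ : i ∈ Finset.univ) => key i)
  unfold absF
  simp only [Finset.sum_sub_distrib, Finset.sum_add_distrib, Finset.sum_const, Finset.card_univ,
    Fintype.card_fin, nsmul_eq_mul] at h5 h4 ⊢
  linarith

lemma EntLike.absF_insert (hh : EntLike h) (Q : Finset (FG r)) (q : FG r) (hq : q ∈ Q)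
    (k : Fin r) (s : FG r) (hs : s = FreeGroup.of k ∨ s = (FreeGroup.of k)⁻¹) :
    absF h (insert (q * s) Q) ≤ absF h Q := by
  set Q' := insert (q * s) Q with hQ'
  have hQQ' : Q ⊆ Q' := Finset.subset_insert _ _
  set D := h Q' - h Q with hD
  have gen1 : ∀ i : Fin r, h (Q' ∪ rt Q' (FreeGroup.of i)) ≤
      h (Q ∪ rt Q (FreeGroup.of i)) + 2 * D := by
    intro i
    set t : FG r := FreeGroup.of i
    have h1 := hh.sub (Q ∪ rt Q t) Q' Q Finset.subset_union_left hQQ'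
    have h2 := hh.sub (Q ∪ rt Q t ∪ Q') (rt Q' t) (rt Q t)
      (Finset.subset_union_right.trans Finset.subset_union_left) (rt_mono hQQ' t)
    rw [hh.inv, hh.inv] at h2
    have h3 := hh.mono (Q' ∪ rt Q' t) (Q ∪ rt Q t ∪ Q' ∪ rt Q' t)
      (Finset.union_subset_union_left Finset.subset_union_right)
    linarith
  have gen2 : h (Q' ∪ rt Q' (FreeGroup.of k)) ≤ h (Q ∪ rt Q (FreeGroup.of k)) + D := by
    rcases hs with hs | hs
    · have h2 := hh.sub (Q ∪ rt Q s) (rt Q' s) (rt Q s)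
        Finset.subset_union_right (rt_mono hQQ' s)
      rw [hh.inv, hh.inv] at h2
      have h3 := hh.mono (Q' ∪ rt Q' s) (Q ∪ rt Q s ∪ rt Q' s) (by
        apply Finset.union_subset_union_left
        rw [hQ', Finset.insert_subset_iff]
        exact ⟨Finset.mem_union_right _ (mem_rt.2 ⟨q, hq, rfl⟩), Finset.subset_union_left⟩)
      rw [← hs]
      linarith
    · have h2 := hh.sub (Q ∪ rt Q (FreeGroup.of k)) Q' Q Finset.subset_union_left hQQ'
      have h3 := hh.mono (Q' ∪ rt Q' (FreeGroup.of k)) (Q ∪ rt Q (FreeGroup.of k) ∪ Q') (by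
        apply Finset.union_subset Finset.subset_union_right
        intro x hx
        obtain ⟨a, ha, rfl⟩ := mem_rt.1 hx
        rw [hQ', Finset.mem_insert] at ha
        rcases ha with rfl | ha
        · rw [hs, inv_mul_cancel_right]
          exact Finset.mem_union_left _ (Finset.mem_union_left _ hq)
        · exact Finset.mem_union_left _ (Finset.mem_union_right _ (mem_rt.2 ⟨a, ha, rfl⟩)))
      linarith
  have key : ∑ i : Fin r, h (Q' ∪ rt Q' (FreeGroup.of i)) ≤
      ∑ i : Fin r, (h (Q ∪ rt Q (FreeGroup.of i)) + 2 * D) - D := by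
    rw [← Finset.add_sum_erase _ _ (Finset.mem_univ k),
      ← Finset.add_sum_erase _ (fun i => h (Q ∪ rt Q (FreeGroup.of i)) + 2 * D)
        (Finset.mem_univ k)]
    have := Finset.sum_le_sum (fun i (_ : i ∈ Finset.univ.erase k) => gen1 i)
    linarith
  unfold absF
  simp only [Finset.sum_add_distrib, Finset.sum_const, Finset.card_univ,
    Fintype.card_fin, nsmul_eq_mul] at key
  have e : h Q' = h Q + D := by rw [hD]; ring
  rw [e]
  linarith

lemma ball_finite (r n : ℕ) : (ball r n).Finite := by
  have h1 : {l : List (Fin r × Bool) | l.length ≤ n}.Finite := List.finite_length_le _ n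
  refine Set.Finite.of_finite_image (f := FreeGroup.toWord) (h1.subset ?_)
    FreeGroup.toWord_injective.injOn
  rintro _ ⟨g, hg, rfl⟩
  exact hg

/-- The ball as a finset. -/
def ballF (r n : ℕ) : Finset (FG r) := (ball_finite r n).toFinset

lemma mem_ballF {r n : ℕ} {g : FG r} : g ∈ ballF r n ↔ FreeGroup.norm g ≤ n := by
  simp [ballF, ball]

lemma exists_prefix {k : ℕ} (g : FG r) (hg : FreeGroup.norm g = k + 1) :
    ∃ (g' s : FG r) (i : Fin r), FreeGroup.norm g' ≤ k ∧
      (s = FreeGroup.of i ∨ s = (FreeGroup.of i)⁻¹) ∧ g = g' * s := by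
  have hl : g.toWord.length = k + 1 := hg
  obtain ⟨L, x, hL⟩ : ∃ L x, g.toWord = L ++ [x] := by
    have : g.toWord ≠ [] := by intro h0; rw [h0] at hl; simp at hl
    exact ⟨_, _, (List.dropLast_append_getLast this).symm⟩
  refine ⟨FreeGroup.mk L, FreeGroup.mk [x], x.1, ?_, ?_, ?_⟩
  · refine FreeGroup.norm_mk_le.trans ?_
    rw [hL] at hl; simp at hl; omega
  · rcases x with ⟨i, b⟩
    cases b
    · right; rfl
    · left; rfl
  · rw [FreeGroup.mul_mk, ← hL, FreeGroup.mk_toWord]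

lemma EntLike.absF_ball (hh : EntLike h) (Q : Finset (FG r)) (h1 : (1 : FG r) ∈ Q) (k : ℕ) :
    absF h (Q ∪ ballF r k) ≤ absF h Q := by
  induction k with
  | zero =>
    have : Q ∪ ballF r 0 = Q := by
      rw [Finset.union_eq_left]
      intro x hx
      rw [mem_ballF, Nat.le_zero, FreeGroup.norm_eq_zero] at hx
      rwa [hx]
    rw [this]
  | succ k ih =>
    refine le_trans ?_ ih
    have step : ∀ E : Finset (FG r), E ⊆ ballF r (k + 1) →
        absF h ((Q ∪ ballF r k) ∪ E) ≤ absF h (Q ∪ ballF r k) := by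
      intro E
      induction E using Finset.induction_on with
      | empty => intro _; simp
      | insert g E hg ihE =>
        intro hsub
        rw [Finset.insert_subset_iff] at hsub
        refine le_trans ?_ (ihE hsub.2)
        rw [Finset.union_insert]
        have hn := mem_ballF.1 hsub.1
        rcases Nat.lt_or_ge k (FreeGroup.norm g) with hlt | hle
        · obtain ⟨g', s, i, hg', hs, rfl⟩ := exists_prefix g (by omega : FreeGroup.norm g = k + 1)
          exact hh.absF_insert _ g' (Finset.mem_union_left _ (Finset.mem_union_right _
            (mem_ballF.2 hg'))) i s hs
        · rw [Finset.insert_eq_of_mem]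
          exact Finset.mem_union_left _ (Finset.mem_union_right _ (mem_ballF.2 hle))
    have e : Q ∪ ballF r (k + 1) = (Q ∪ ballF r k) ∪ ballF r (k + 1) := by
      ext x
      simp only [Finset.mem_union, mem_ballF]
      constructor
      · tauto
      · rintro ((h | h) | h)
        · exact Or.inl h
        · exact Or.inr (by omega)
        · exact Or.inr h
    rw [e]
    exact step _ (Finset.Subset.refl _)

lemma EntLike.exists_ball (hh : EntLike h) (hr : 1 ≤ r) (n : ℕ) {ε : ℝ} (hε : 0 < ε) :
    ∃ N : ℕ, absF h (ballF r (N + 1)) ≤ absFs h (ballF r n) + ε := by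
  set A := ballF r n
  have hr' : (0 : ℝ) < r := by exact_mod_cast hr
  have hm : ∀ i : Fin r, ∃ m : ℕ, h (seg A (FreeGroup.of i) m) / (m + 1) <
      (⨅ n : ℕ, h (seg A (FreeGroup.of i) n) / (n + 1)) + ε / r := fun i =>
    exists_lt_of_ciInf_lt (lt_add_of_pos_right _ (div_pos hε hr'))
  choose m hm using hm
  set Q := star A m
  have hQ1 : (1 : FG r) ∈ Q := subset_star hr A m (mem_ballF.2 (by simp))
  set N := Q.sup FreeGroup.norm
  refine ⟨N, ?_⟩
  have h1 := hh.absF_ball Q hQ1 (N + 1)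
  have e : Q ∪ ballF r (N + 1) = ballF r (N + 1) := by
    rw [Finset.union_eq_right]
    intro x hx
    exact mem_ballF.2 ((Finset.le_sup (f := FreeGroup.norm) hx).trans (Nat.le_succ _))
  rw [e] at h1
  have h2 := hh.absF_star hr A m
  have h3 : ∑ i : Fin r, (h (seg A (FreeGroup.of i) (m i + 1)) - h (seg A (FreeGroup.of i) (m i)))
      ≤ ∑ i : Fin r, ((⨅ n : ℕ, h (seg A (FreeGroup.of i) n) / (n + 1)) + ε / r) := by
    apply Finset.sum_le_sum
    intro i _
    refine le_trans ?_ (hm i).le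
    rw [le_div_iff₀ (by positivity), mul_comm]
    exact hh.seg_diff_le A _ (m i)
  rw [Finset.sum_add_distrib] at h3
  simp only [Finset.sum_const, Finset.card_univ, Fintype.card_fin, nsmul_eq_mul] at h3
  rw [mul_div_cancel₀ _ hr'.ne'] at h3
  unfold absFs
  linarith

theorem EntLike.main (hh : EntLike h) (hr : 1 ≤ r) :
    (⨅ n : ℕ, ((absFs h (ballF r (n + 1)) : ℝ) : EReal)) =
      ⨅ n : ℕ, ((absF h (ballF r (n + 1)) : ℝ) : EReal) := by
  apply le_antisymm
  · exact iInf_mono (fun n => EReal.coe_le_coe_iff.2 (hh.absFs_le _))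
  · refine le_iInf (fun n => ?_)
    refine EReal.le_of_forall_lt_iff_le.1 (fun z hz => ?_)
    rw [EReal.coe_lt_coe_iff] at hz
    obtain ⟨N, hN⟩ := hh.exists_ball hr (n + 1) (sub_pos.2 hz)
    refine (iInf_le _ N).trans (EReal.coe_le_coe_iff.2 ?_)
    linarith

end Comb

section Ent

open ProbabilityTheory

variable {X : Type*} [mX : MeasurableSpace X]
variable {K L M : Type*} [Countable K] [Countable L] [Countable M]
  [MeasurableSpace K] [MeasurableSpace L] [MeasurableSpace M]
  [MeasurableSingletonClass K] [MeasurableSingletonClass L] [MeasurableSingletonClass M]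

/-- Information function. -/
def info (ν : Measure X) (p : X → K) (x : X) : ℝ≥0∞ :=
  ENNReal.ofReal (- Real.log (ν.real (p ⁻¹' {p x})))

lemma measurable_info (ν : Measure X) {p : X → K} (hp : Measurable p) :
    Measurable (info ν p) :=
  (Measurable.of_discrete (f := fun k : K =>
    ENNReal.ofReal (- Real.log (ν.real (p ⁻¹' {k}))))).comp hp

lemma ofReal_negMulLog (ν : Measure X) [IsProbabilityMeasure ν] (A : Set X) :
    ENNReal.ofReal (Real.negMulLog (ν A).toReal) =
      ENNReal.ofReal (- Real.log (ν.real A)) * ν A := by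
  have h1 : ν A = ENNReal.ofReal (ν.real A) := by simp
  conv_rhs => rw [h1]
  have h2 : ν.real A ≤ 1 := measureReal_le_one
  rw [← ENNReal.ofReal_mul (by have := Real.log_nonpos measureReal_nonneg h2; linarith)]
  congr 1
  rw [Real.negMulLog]
  simp only [Measure.real]
  ring

lemma lintegral_comp_countable (ν : Measure X) {p : X → K} (hp : Measurable p) (f : K → ℝ≥0∞) :
    ∫⁻ x, f (p x) ∂ν = ∑' k, f k * ν (p ⁻¹' {k}) := by
  rw [← lintegral_map (Measurable.of_discrete (f := f)) hp, lintegral_countable']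
  congr 1
  ext k
  rw [Measure.map_apply hp (measurableSet_singleton k)]

lemma Hpart_eq (ν : Measure X) [IsProbabilityMeasure ν] {p : X → K} (hp : Measurable p) :
    Hpart ν p = ∫⁻ x, info ν p x ∂ν := by
  unfold info Hpart
  rw [lintegral_comp_countable ν hp
    (fun k => ENNReal.ofReal (- Real.log (ν.real (p ⁻¹' {k}))))]
  congr 1
  ext k
  exact ofReal_negMulLog ν _

lemma ae_atom_pos (ν : Measure X) (p : X → K) :
    ∀ᵐ x ∂ν, ν (p ⁻¹' {p x}) ≠ 0 := by
  rw [ae_iff]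
  refine measure_mono_null (t := ⋃ k : {k : K // ν (p ⁻¹' {k}) = 0}, p ⁻¹' {k.1}) ?_
    (measure_iUnion_null (fun k => k.2))
  intro x hx
  simp only [ne_eq, not_not, Set.mem_ofPred_eq] at hx
  exact Set.mem_iUnion.2 ⟨⟨p x, hx⟩, rfl⟩

lemma Hpart_mono (ν : Measure X) [IsProbabilityMeasure ν] {p : X → K} {q : X → L}
    (hp : Measurable p) (hq : Measurable q) (hpq : ∀ x y, q x = q y → p x = p y) :
    Hpart ν p ≤ Hpart ν q := by
  rw [Hpart_eq ν hp, Hpart_eq ν hq]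
  refine lintegral_mono_ae ?_
  filter_upwards [ae_atom_pos ν q] with x hx
  apply ENNReal.ofReal_le_ofReal
  apply neg_le_neg
  have h1 : 0 < ν.real (q ⁻¹' {q x}) := ENNReal.toReal_pos hx (measure_ne_top _ _)
  exact Real.log_le_log h1 (measureReal_mono (fun y hy => hpq y x hy))

lemma tsum_inter_le (ν : Measure X) {p : X → K} (hp : Measurable p) {S : Set X}
    (hS : MeasurableSet S) : ∑' k, ν (p ⁻¹' {k} ∩ S) ≤ ν S := by
  refine (tsum_meas_le_meas_iUnion_of_disjoint ν
    (fun k => (hp (measurableSet_singleton k)).inter hS) ?_).trans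
    (measure_mono (Set.iUnion_subset fun k => Set.inter_subset_right))
  intro i j hij
  refine Set.disjoint_left.2 ?_
  rintro x ⟨hx, _⟩ ⟨hy, _⟩
  exact hij (hx.symm.trans hy)

lemma Hpart_sub (ν : Measure X) [IsProbabilityMeasure ν] {p : X → K} {q : X → L} {w : X → M}
    (hp : Measurable p) (hq : Measurable q) (hw : Measurable w) :
    Hpart ν (fun x => (w x, p x, q x)) + Hpart ν w ≤
      Hpart ν (fun x => (p x, w x)) + Hpart ν (fun x => (q x, w x)) := by
  have hpw : Measurable (fun x => (p x, w x)) := hp.prodMk hw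
  have hqw : Measurable (fun x => (q x, w x)) := hq.prodMk hw
  have hwpq : Measurable (fun x => (w x, p x, q x)) := hw.prodMk (hp.prodMk hq)
  set P : X → M × K × L := fun x => (w x, p x, q x) with hP
  set g : M × K × L → ℝ := fun t =>
    ν.real ((fun x => (p x, w x)) ⁻¹' {(t.2.1, t.1)}) *
      ν.real ((fun x => (q x, w x)) ⁻¹' {(t.2.2, t.1)}) /
      (ν.real (w ⁻¹' {t.1}) * ν.real (P ⁻¹' {t})) with hg
  have hg0 : ∀ t, 0 ≤ g t := fun t => by
    rw [hg]; dsimp only; exact div_nonneg (mul_nonneg measureReal_nonneg measureReal_nonneg)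
      (mul_nonneg measureReal_nonneg measureReal_nonneg)
  have hone : ∫⁻ x, ENNReal.ofReal (g (P x)) ∂ν ≤ 1 := by
    rw [lintegral_comp_countable ν hwpq (fun t => ENNReal.ofReal (g t))]
    have hterm : ∀ t : M × K × L, ENNReal.ofReal (g t) * ν (P ⁻¹' {t}) ≤
        (ν (p ⁻¹' {t.2.1} ∩ w ⁻¹' {t.1}) / ν (w ⁻¹' {t.1})) *
          ν (q ⁻¹' {t.2.2} ∩ w ⁻¹' {t.1}) := by
      rintro ⟨c, a, b⟩
      have e1 : (fun x => (p x, w x)) ⁻¹' {(a, c)} = p ⁻¹' {a} ∩ w ⁻¹' {c} := by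
        ext x; simp
      have e2 : (fun x => (q x, w x)) ⁻¹' {(b, c)} = q ⁻¹' {b} ∩ w ⁻¹' {c} := by
        ext x; simp
      rw [hg]
      dsimp only
      rw [e1, e2]
      by_cases h0 : ν (P ⁻¹' {(c, a, b)}) = 0
      · rw [h0]; simp
      have hsub : P ⁻¹' {(c, a, b)} ⊆ w ⁻¹' {c} := by
        intro x hx
        simp only [hP, Set.mem_preimage, Set.mem_singleton_iff, Prod.mk.injEq] at hx
        exact hx.1
      have hc : ν (w ⁻¹' {c}) ≠ 0 := fun h => h0 (measure_mono_null hsub h)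
      have hc' : 0 < ν.real (w ⁻¹' {c}) := ENNReal.toReal_pos hc (measure_ne_top _ _)
      have h0' : 0 < ν.real (P ⁻¹' {(c, a, b)}) := ENNReal.toReal_pos h0 (measure_ne_top _ _)
      have r1 : ∀ S, ν S = ENNReal.ofReal (ν.real S) := fun S => by simp
      rw [r1 (P ⁻¹' {(c, a, b)}), r1 (p ⁻¹' {a} ∩ w ⁻¹' {c}), r1 (w ⁻¹' {c}),
        r1 (q ⁻¹' {b} ∩ w ⁻¹' {c}), ← ENNReal.ofReal_div_of_pos hc',
        ← ENNReal.ofReal_mul (by positivity), ← ENNReal.ofReal_mul (by positivity)]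
      apply ENNReal.ofReal_le_ofReal
      apply le_of_eq
      field_simp
    refine (ENNReal.tsum_le_tsum hterm).trans ?_
    rw [ENNReal.tsum_prod (f := fun (c : M) (t : K × L) =>
      (ν (p ⁻¹' {t.1} ∩ w ⁻¹' {c}) / ν (w ⁻¹' {c})) * ν (q ⁻¹' {t.2} ∩ w ⁻¹' {c}))]
    have hpr : ∀ c : M, ∑' t : K × L,
        (ν (p ⁻¹' {t.1} ∩ w ⁻¹' {c}) / ν (w ⁻¹' {c})) * ν (q ⁻¹' {t.2} ∩ w ⁻¹' {c}) =
        ∑' (a : K) (b : L),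
        (ν (p ⁻¹' {a} ∩ w ⁻¹' {c}) / ν (w ⁻¹' {c})) * ν (q ⁻¹' {b} ∩ w ⁻¹' {c}) := fun c =>
      ENNReal.tsum_prod (f := fun (a : K) (b : L) =>
        (ν (p ⁻¹' {a} ∩ w ⁻¹' {c}) / ν (w ⁻¹' {c})) * ν (q ⁻¹' {b} ∩ w ⁻¹' {c}))
    simp_rw [hpr, ENNReal.tsum_mul_left, ENNReal.tsum_mul_right]
    have hle : ∀ c : M, (∑' a, ν (p ⁻¹' {a} ∩ w ⁻¹' {c}) / ν (w ⁻¹' {c})) *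
        ∑' b, ν (q ⁻¹' {b} ∩ w ⁻¹' {c}) ≤ ν (w ⁻¹' {c} ∩ Set.univ) := by
      intro c
      have hS := hw (measurableSet_singleton c)
      simp_rw [div_eq_mul_inv, ENNReal.tsum_mul_right, Set.inter_univ]
      calc _ ≤ ν (w ⁻¹' {c}) * (ν (w ⁻¹' {c}))⁻¹ * ν (w ⁻¹' {c}) := by
            gcongr
            · exact tsum_inter_le ν hp hS
            · exact tsum_inter_le ν hq hS
        _ ≤ 1 * ν (w ⁻¹' {c}) := by
            gcongr
            exact ENNReal.mul_inv_le_one _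
        _ = _ := one_mul _
    refine (ENNReal.tsum_le_tsum hle).trans ?_
    exact (tsum_inter_le ν hw MeasurableSet.univ).trans_eq measure_univ
  rw [Hpart_eq ν hwpq, Hpart_eq ν hw, Hpart_eq ν hpw, Hpart_eq ν hqw]
  refine (ENNReal.add_le_add_iff_right (ENNReal.one_ne_top)).1 ?_
  have hmain : ∫⁻ x, info ν P x + info ν w x + 1 ∂ν ≤
      ∫⁻ x, info ν (fun x => (p x, w x)) x + info ν (fun x => (q x, w x)) x
        + ENNReal.ofReal (g (P x)) ∂ν := by
    refine lintegral_mono_ae ?_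
    filter_upwards [ae_atom_pos ν P] with x hx
    have hmono : ∀ {S : Set X}, P ⁻¹' {P x} ⊆ S → 0 < ν.real S := fun {S} hS =>
      ENNReal.toReal_pos (fun h => hx (measure_mono_null hS h)) (measure_ne_top _ _)
    have hP' : 0 < ν.real (P ⁻¹' {P x}) := hmono (subset_refl _)
    have hw' : 0 < ν.real (w ⁻¹' {w x}) := hmono (fun y hy => (Prod.mk.inj hy).1)
    have hpw' : 0 < ν.real ((fun x => (p x, w x)) ⁻¹' {(p x, w x)}) := hmono (fun y hy => by
      have h1 := Prod.mk.inj hy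
      have h2 := Prod.mk.inj h1.2
      exact Prod.ext h2.1 h1.1)
    have hqw' : 0 < ν.real ((fun x => (q x, w x)) ⁻¹' {(q x, w x)}) := hmono (fun y hy => by
      have h1 := Prod.mk.inj hy
      have h2 := Prod.mk.inj h1.2
      exact Prod.ext h2.2 h1.1)
    have hlog : ∀ S : Set X, 0 ≤ - Real.log (ν.real S) := fun S => by
      have := Real.log_nonpos (measureReal_nonneg (μ := ν) (s := S)) measureReal_le_one
      linarith
    unfold info
    rw [← ENNReal.ofReal_one, ← ENNReal.ofReal_add (hlog _) (hlog _),
      ← ENNReal.ofReal_add (add_nonneg (hlog _) (hlog _)) zero_le_one,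
      ← ENNReal.ofReal_add (hlog _) (hlog _),
      ← ENNReal.ofReal_add (add_nonneg (hlog _) (hlog _)) (hg0 _)]
    apply ENNReal.ofReal_le_ofReal
    have hgx : g (P x) = ν.real ((fun x => (p x, w x)) ⁻¹' {(p x, w x)}) *
      ν.real ((fun x => (q x, w x)) ⁻¹' {(q x, w x)}) /
      (ν.real (w ⁻¹' {w x}) * ν.real (P ⁻¹' {P x})) := rfl
    have hgpos : 0 < g (P x) := by rw [hgx]; positivity
    have := Real.log_le_sub_one_of_pos hgpos
    rw [hgx, Real.log_div (by positivity) (by positivity), Real.log_mul hpw'.ne' hqw'.ne',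
      Real.log_mul hw'.ne' hP'.ne', ← hgx] at this
    linarith
  have hgm : Measurable (fun x => ENNReal.ofReal (g (P x))) :=
    (Measurable.of_discrete (f := fun t => ENNReal.ofReal (g t))).comp hwpq
  rw [lintegral_add_right _ measurable_const,
    lintegral_add_left (measurable_info ν hwpq),
    lintegral_add_right _ hgm,
    lintegral_add_left (measurable_info ν hpw)] at hmain
  simp only [lintegral_const, measure_univ, mul_one] at hmain
  exact hmain.trans (add_le_add le_rfl hone)

end Ent

section Ent2

open ProbabilityTheory

variable {X : Type*} {m : MeasurableSpace X} [mX : MeasurableSpace X] [StandardBorelSpace X]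
variable {K L M : Type*} [Countable K] [Countable L] [Countable M]
  [MeasurableSpace K] [MeasurableSpace L] [MeasurableSpace M]
  [MeasurableSingletonClass K] [MeasurableSingletonClass L] [MeasurableSingletonClass M]

lemma lintegral_indicator_kernel (μ : Measure X) [IsProbabilityMeasure μ]
    (hm : m ≤ mX) {A : Set X} (hA : MeasurableSet A)
    {g : X → ℝ≥0∞} (hg : Measurable[m] g) :
    ∫⁻ x, A.indicator g x ∂μ = ∫⁻ x, g x * condExpKernel μ m x A ∂μ := by
  have hk : Measurable[m] (fun x => condExpKernel μ m x A) := measurable_condExpKernel hA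
  have hf : Measurable[m.prod mX] (fun z : X × X => g z.1 * A.indicator (fun _ => (1 : ℝ≥0∞)) z.2) :=
    (hg.comp (@measurable_fst X X m mX)).mul
      ((measurable_const.indicator hA).comp (@measurable_snd X X m mX))
  have h := Measure.lintegral_compProd (μ := μ.trim hm) (κ := condExpKernel μ m) hf
  have hd : @Measurable X (X × X) mX (m.prod mX) Function.diag :=
    @Measurable.prodMk X mX X X m mX id id (measurable_id'' hm) measurable_id
  rw [compProd_trim_condExpKernel hm, @lintegral_map X (X × X) mX (m.prod mX) μ _ _ hf hd] at h
  have e1 : ∀ x, A.indicator g x = g x * A.indicator (fun _ => (1 : ℝ≥0∞)) x := by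
    intro x
    by_cases hx : x ∈ A <;> simp [hx]
  simp_rw [e1]
  refine h.trans ?_
  rw [lintegral_trim hm]
  · congr 1
    ext x
    dsimp only
    rw [lintegral_const_mul _ (measurable_const.indicator hA), lintegral_indicator hA]
    simp
  · have e2 : (fun x => ∫⁻ y, g x * A.indicator (fun _ => (1 : ℝ≥0∞)) y ∂condExpKernel μ m x) =
        fun x => g x * condExpKernel μ m x A := by
      ext x
      rw [lintegral_const_mul _ (measurable_const.indicator hA), lintegral_indicator hA]
      simp
    exact e2 ▸ hg.mul hk

lemma HpartC_eq (μ : Measure X) [IsProbabilityMeasure μ] (hm : m ≤ mX) {p : X → K}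
    (hp : Measurable p) :
    HpartC μ p m = ∫⁻ x, Hpart (condExpKernel μ m x) p ∂μ := by
  have hA : ∀ k, MeasurableSet (p ⁻¹' {k}) := fun k => hp (measurableSet_singleton k)
  set G : K → X → ℝ≥0∞ := fun k x =>
    ENNReal.ofReal (- Real.log ((condExpKernel μ m x).real (p ⁻¹' {k}))) with hG
  have hGm : ∀ k, Measurable[m] (G k) := fun k =>
    ((Real.measurable_log.comp
      (measurable_condExpKernel (hA k)).ennreal_toReal).neg).ennreal_ofReal
  have h1 : HpartC μ p m = ∫⁻ x, ∑' k, (p ⁻¹' {k}).indicator (G k) x ∂μ := by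
    unfold HpartC
    refine lintegral_congr_ae ?_
    have hae : ∀ᵐ x ∂μ, ∀ k, (condExpKernel μ m x).real (p ⁻¹' {k}) =
        (μ[(p ⁻¹' {k}).indicator (fun _ => (1:ℝ)) | m]) x :=
      ae_all_iff.2 (fun k => condExpKernel_ae_eq_condExp hm (hA k))
    filter_upwards [hae] with x hx
    rw [tsum_eq_single (p x)]
    · rw [Set.indicator_of_mem (by simp), hG]
      dsimp only
      rw [hx]
      rfl
    · intro k hk
      rw [Set.indicator_of_notMem]
      intro hx
      exact hk hx.symm
  rw [h1, lintegral_tsum (fun k => (((hGm k).mono hm le_rfl).indicator (hA k)).aemeasurable)]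
  unfold Hpart
  rw [lintegral_tsum]
  · congr 1
    ext k
    rw [lintegral_indicator_kernel μ hm (hA k) (hGm k)]
    congr 1
    ext x
    exact (ofReal_negMulLog _ _).symm
  · intro k
    have : Measurable[m] (fun x => ENNReal.ofReal
        (Real.negMulLog ((condExpKernel μ m x) (p ⁻¹' {k})).toReal)) :=
      (Real.continuous_negMulLog.measurable.comp
        (measurable_condExpKernel (hA k)).ennreal_toReal).ennreal_ofReal
    exact (this.mono hm le_rfl).aemeasurable

lemma measurable_Hpart_kernel (μ : Measure X) [IsProbabilityMeasure μ] (hm : m ≤ mX) {p : X → K}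
    (hp : Measurable p) : Measurable (fun x => Hpart (condExpKernel μ m x) p) := by
  unfold Hpart
  refine Measurable.tsum (fun k => ?_)
  have : Measurable[m] (fun x => ENNReal.ofReal
      (Real.negMulLog ((condExpKernel μ m x) (p ⁻¹' {k})).toReal)) :=
    (Real.continuous_negMulLog.measurable.comp
      (measurable_condExpKernel (hp (measurableSet_singleton k))).ennreal_toReal).ennreal_ofReal
  exact this.mono hm le_rfl

lemma HpartC_mono (μ : Measure X) [IsProbabilityMeasure μ] (hm : m ≤ mX) {p : X → K} {q : X → L}
    (hp : Measurable p) (hq : Measurable q) (hpq : ∀ x y, q x = q y → p x = p y) :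
    HpartC μ p m ≤ HpartC μ q m := by
  rw [HpartC_eq μ hm hp, HpartC_eq μ hm hq]
  exact lintegral_mono (fun x => Hpart_mono _ hp hq hpq)

lemma HpartC_sub (μ : Measure X) [IsProbabilityMeasure μ] (hm : m ≤ mX)
    {p : X → K} {q : X → L} {w : X → M}
    (hp : Measurable p) (hq : Measurable q) (hw : Measurable w) :
    HpartC μ (fun x => (w x, p x, q x)) m + HpartC μ w m ≤
      HpartC μ (fun x => (p x, w x)) m + HpartC μ (fun x => (q x, w x)) m := by
  have hpw : Measurable (fun x => (p x, w x)) := hp.prodMk hw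
  have hqw : Measurable (fun x => (q x, w x)) := hq.prodMk hw
  have hwpq : Measurable (fun x => (w x, p x, q x)) := hw.prodMk (hp.prodMk hq)
  rw [HpartC_eq μ hm hpw, HpartC_eq μ hm hqw, HpartC_eq μ hm hwpq, HpartC_eq μ hm hw,
    ← lintegral_add_left (measurable_Hpart_kernel μ hm hwpq),
    ← lintegral_add_left (measurable_Hpart_kernel μ hm hpw)]
  exact lintegral_mono (fun x => Hpart_sub _ hp hq hw)

lemma HpartC_le (μ : Measure X) [IsProbabilityMeasure μ] (hm : m ≤ mX) {p : X → K}
    (hp : Measurable p) : HpartC μ p m ≤ Hpart μ p := by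
  have hA : ∀ k, MeasurableSet (p ⁻¹' {k}) := fun k => hp (measurableSet_singleton k)
  have hmeas : ∀ k, Measurable (fun x =>
      (Real.negMulLog ((condExpKernel μ m x).real (p ⁻¹' {k})))) := fun k => by
    have : Measurable[m] (fun x =>
        (Real.negMulLog ((condExpKernel μ m x).real (p ⁻¹' {k})))) :=
      Real.continuous_negMulLog.measurable.comp
        (measurable_condExpKernel (hA k)).ennreal_toReal
    exact this.mono hm le_rfl
  rw [HpartC_eq μ hm hp]
  unfold Hpart
  simp_rw [← measureReal_def]
  rw [lintegral_tsum (fun k => (hmeas k).ennreal_ofReal.aemeasurable)]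
  refine ENNReal.tsum_le_tsum (fun k => ?_)
  have hnn : ∀ x, 0 ≤ Real.negMulLog ((condExpKernel μ m x).real (p ⁻¹' {k})) := fun x =>
    Real.negMulLog_nonneg measureReal_nonneg measureReal_le_one
  have hint : Integrable (fun x => (condExpKernel μ m x).real (p ⁻¹' {k})) μ :=
    integrable_toReal_condExpKernel (hA k)
  have hint2 : Integrable (Real.negMulLog ∘ fun x => (condExpKernel μ m x).real (p ⁻¹' {k})) μ := by
    obtain ⟨C, hC⟩ := (isCompact_Icc (a := (0:ℝ)) (b := 1)).exists_bound_of_continuousOn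
      Real.continuous_negMulLog.continuousOn
    refine Integrable.of_bound (hmeas k).aestronglyMeasurable C (Eventually.of_forall fun x => ?_)
    exact hC _ ⟨measureReal_nonneg, measureReal_le_one⟩
  have hj := Real.concaveOn_negMulLog.le_map_average Real.continuous_negMulLog.continuousOn
    isClosed_Ici (μ := μ) (f := fun x => (condExpKernel μ m x).real (p ⁻¹' {k}))
    (Eventually.of_forall fun x => measureReal_nonneg) hint hint2
  rw [average_eq_integral, average_eq_integral] at hj
  have hI : ∫ x, (condExpKernel μ m x).real (p ⁻¹' {k}) ∂μ = μ.real (p ⁻¹' {k}) := by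
    rw [integral_congr_ae (condExpKernel_ae_eq_condExp hm (hA k)), integral_condExp hm,
      integral_indicator (hA k)]
    simp
  rw [hI] at hj
  have := ofReal_integral_eq_lintegral_ofReal hint2 (Eventually.of_forall hnn)
  refine this.symm.le.trans (ENNReal.ofReal_le_ofReal ?_)
  exact hj

lemma condExp_comp_mp (μ : Measure X) [IsProbabilityMeasure μ] (hm : m ≤ mX) {S : X → X}
    (hS : MeasurePreserving S μ μ) (hmS : m.comap S = m) {A : Set X} (hA : MeasurableSet A) :
    (fun x => (μ[A.indicator (fun _ => (1:ℝ)) | m]) (S x)) =ᵐ[μ]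
      μ[(S ⁻¹' A).indicator (fun _ => (1:ℝ)) | m] := by
  have hSm : Measurable[m, m] S := by
    intro s hs
    rw [← hmS]
    exact ⟨s, hs, rfl⟩
  have hi : Integrable (A.indicator (fun _ => (1:ℝ))) μ := (integrable_const _).indicator hA
  have hsm : StronglyMeasurable[m] (μ[A.indicator (fun _ => (1:ℝ)) | m]) :=
    stronglyMeasurable_condExp
  refine ae_eq_condExp_of_forall_setIntegral_eq hm
    ((integrable_const _).indicator (hS.measurable hA)) ?_ ?_
    (hsm.comp_measurable hSm).aestronglyMeasurable
  · intro s _ _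
    exact (hS.integrable_comp_of_integrable integrable_condExp).integrableOn
  · intro s hs _
    rw [← hmS] at hs
    obtain ⟨t, ht, rfl⟩ := hs
    have e : (S ⁻¹' A).indicator (fun _ => (1:ℝ)) = fun x => A.indicator (fun _ => (1:ℝ)) (S x) := by
      ext x; rfl
    rw [e]
    have ht' := hm t ht
    have hr : ∀ f : X → ℝ, AEStronglyMeasurable f μ →
        ∫ x in S ⁻¹' t, f (S x) ∂μ = ∫ x in t, f x ∂μ := by
      intro f hf
      have hSr := hS.restrict_preimage ht'
      rw [← hSr.map_eq, integral_map hS.measurable.aemeasurable]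
      rw [hSr.map_eq]
      exact hf.restrict
    rw [hr _ integrable_condExp.aestronglyMeasurable, hr _ hi.aestronglyMeasurable]
    exact setIntegral_condExp hm hi ht

lemma HpartC_comp (μ : Measure X) [IsProbabilityMeasure μ] (hm : m ≤ mX) {S : X → X}
    (hS : MeasurePreserving S μ μ) (hemb : MeasurableEmbedding S) (hmS : m.comap S = m)
    {p : X → K} (hp : Measurable p) :
    HpartC μ (fun x => p (S x)) m = HpartC μ p m := by
  unfold HpartC
  rw [← hS.lintegral_comp_emb hemb (fun x => ENNReal.ofReal
    (- Real.log ((μ[(atomOf p x).indicator (fun _ => (1:ℝ)) | m]) x)))]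
  refine lintegral_congr_ae ?_
  have : ∀ᵐ x ∂μ, ∀ k, (μ[(p ⁻¹' {k}).indicator (fun _ => (1:ℝ)) | m]) (S x) =
      (μ[(S ⁻¹' (p ⁻¹' {k})).indicator (fun _ => (1:ℝ)) | m]) x :=
    ae_all_iff.2 (fun k => condExp_comp_mp μ hm hS hmS (hp (measurableSet_singleton k)))
  filter_upwards [this] with x hx
  have h1 := hx (p (S x))
  unfold atomOf
  rw [h1]
  rfl

end Ent2

section Final

lemma HpartC_congr {X : Type*} [mX : MeasurableSpace X] (μ : Measure X) (m : MeasurableSpace X)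
    {K L : Type*} {p : X → K} {q : X → L} (hpq : ∀ x y, p x = p y ↔ q x = q y) :
    HpartC (mX := mX) μ p m = HpartC (mX := mX) μ q m := by
  have : ∀ x, atomOf p x = atomOf q x := by
    intro x
    ext y
    exact hpq y x
  unfold HpartC
  simp_rw [this]

/-- The entropy set function. -/
def entS {X : Type*} [mX : MeasurableSpace X] {r : ℕ} (T : FG r → X → X) (μ : Measure X)
    (m : MeasurableSpace X) (α : X → ℕ) (A : Finset (FG r)) : ℝ≥0∞ :=
  HpartC (mX := mX) μ (powS T α (A : Set (FG r))) m

lemma powS_eq_iff {X : Type*} {r : ℕ} (T : FG r → X → X) (α : X → ℕ) (Q : Set (FG r)) (x y : X) :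
    powS T α Q x = powS T α Q y ↔ ∀ g ∈ Q, α (T g x) = α (T g y) := by
  constructor
  · intro h g hg
    exact congrFun h ⟨g, hg⟩
  · intro h
    funext g
    exact h g.1 g.2

lemma comap_sAlgG {X : Type*} {r : ℕ} (T : FG r → X → X)
    (hTmul : ∀ g h : FG r, T (g * h) = T g ∘ T h) (β : X → ℕ) (g : FG r) :
    (sAlgG T β).comap (T g) = sAlgG T β := by
  unfold sAlgG sAlg
  rw [MeasurableSpace.comap_iSup]
  simp_rw [MeasurableSpace.comap_comp]
  refine (Equiv.mulRight g).iSup_congr (fun h => ?_)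
  congr 1
  funext x
  simp [pull, hTmul]

lemma sAlgG_le {X : Type*} [mX : MeasurableSpace X] {r : ℕ} (T : FG r → X → X)
    (hT : ∀ g, Measurable (T g)) {β : X → ℕ} (hβ : Measurable β) : sAlgG T β ≤ mX := by
  refine iSup_le (fun g => ?_)
  exact measurable_iff_comap_le.1 (hβ.comp (hT g))

lemma entLike_entS {r : ℕ} {X : Type*} {m : MeasurableSpace X} [mX : MeasurableSpace X]
    [StandardBorelSpace X] (μ : Measure X) [IsProbabilityMeasure μ]
    (T : FG r → X → X) (hT1 : T 1 = id)
    (hTmul : ∀ g h : FG r, T (g * h) = T g ∘ T h)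
    (hTmp : ∀ g : FG r, MeasurePreserving (T g) μ μ)
    (α : X → ℕ) (hαm : Measurable α) (hHα : Hpart μ α < ⊤) (hm : m ≤ mX)
    (hinv : ∀ g, m.comap (T g) = m) :
    EntLike (fun A => (entS T μ m α A).toReal) := by
  have hmeas : ∀ A : Finset (FG r), Measurable (powS T α (A : Set (FG r))) := fun A =>
    measurable_pi_lambda _ (fun g => hαm.comp (hTmp g).measurable)
  have hemb : ∀ g, MeasurableEmbedding (T g) := fun g => by
    refine MeasurableEmbedding.of_measurable_inverse (g := T g⁻¹) (hTmp g).measurable ?_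
      (hTmp g⁻¹).measurable ?_
    · have : Set.range (T g) = Set.univ := by
        rw [Set.range_eq_univ]
        intro x
        refine ⟨T g⁻¹ x, ?_⟩
        have := congrFun (hTmul g g⁻¹) x
        rw [mul_inv_cancel, hT1] at this
        exact this.symm
      rw [this]
      exact MeasurableSet.univ
    · intro x
      have := congrFun (hTmul g⁻¹ g) x
      rw [inv_mul_cancel, hT1] at this
      exact this.symm
  have mono : ∀ A B : Finset (FG r), A ⊆ B → entS T μ m α A ≤ entS T μ m α B := by
    intro A B hAB
    refine HpartC_mono μ hm (hmeas A) (hmeas B) (fun x y hxy => ?_)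
    rw [powS_eq_iff] at hxy ⊢
    exact fun g hg => hxy g (hAB hg)
  have sub : ∀ A B C : Finset (FG r), C ⊆ A → C ⊆ B →
      entS T μ m α (A ∪ B) + entS T μ m α C ≤ entS T μ m α A + entS T μ m α B := by
    intro A B C hCA hCB
    have h := HpartC_sub μ hm (hmeas A) (hmeas B) (hmeas C)
    have e1 : HpartC μ (fun x => (powS T α (C : Set (FG r)) x, powS T α (A : Set (FG r)) x,
        powS T α (B : Set (FG r)) x)) m = entS T μ m α (A ∪ B) := by
      refine HpartC_congr μ m (fun x y => ?_)
      simp only [Prod.mk.injEq, powS_eq_iff, Finset.mem_coe, Finset.mem_union]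
      constructor
      · rintro ⟨_, h2, h3⟩ g (hg | hg)
        · exact h2 g hg
        · exact h3 g hg
      · intro h
        exact ⟨fun g hg => h g (Or.inl (hCA hg)), fun g hg => h g (Or.inl hg),
          fun g hg => h g (Or.inr hg)⟩
    have e2 : ∀ D : Finset (FG r), C ⊆ D → HpartC μ (fun x => (powS T α (D : Set (FG r)) x,
        powS T α (C : Set (FG r)) x)) m = entS T μ m α D := by
      intro D hD
      refine HpartC_congr μ m (fun x y => ?_)
      simp only [Prod.mk.injEq, powS_eq_iff, Finset.mem_coe]
      exact ⟨fun h => h.1, fun h => ⟨h, fun g hg => h g (hD hg)⟩⟩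
    rw [e1, e2 A hCA, e2 B hCB] at h
    exact h
  have inv : ∀ A g, entS T μ m α (rt A g) = entS T μ m α A := by
    intro A g
    unfold entS
    rw [← HpartC_comp μ hm (hTmp g) (hemb g) (hinv g) (hmeas A)]
    refine HpartC_congr μ m (fun x y => ?_)
    simp only [powS_eq_iff, Finset.mem_coe, mem_rt]
    constructor
    · intro h a ha
      have := h (a * g) ⟨a, ha, rfl⟩
      rwa [hTmul] at this
    · rintro h _ ⟨a, ha, rfl⟩
      rw [hTmul]
      exact h a ha
  have empty : entS T μ m α ∅ = 0 := by
    refine le_antisymm ?_ bot_le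
    refine (HpartC_le μ hm (hmeas ∅)).trans (le_of_eq ?_)
    unfold Hpart
    rw [ENNReal.tsum_eq_zero]
    intro k
    have : powS T α ((∅ : Finset (FG r)) : Set (FG r)) ⁻¹' {k} = Set.univ := by
      ext x
      simp only [Set.mem_preimage, Set.mem_singleton_iff, Set.mem_univ, iff_true]
      funext g
      exact absurd g.2 (by simp)
    rw [this]
    simp
  have single : ∀ g, entS T μ m α {g} < ⊤ := by
    intro g
    have e : ({g} : Finset (FG r)) = rt {1} g := by simp [rt]
    rw [e, inv]
    refine lt_of_le_of_lt ?_ hHα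
    refine le_trans (le_of_eq ?_) (HpartC_le μ hm hαm)
    refine HpartC_congr μ m (fun x y => ?_)
    rw [powS_eq_iff]
    simp [hT1]
  have fin : ∀ A, entS T μ m α A ≠ ⊤ := by
    intro A
    induction A using Finset.induction_on with
    | empty => rw [empty]; simp
    | insert g A _ ih =>
      have h := sub {g} A ∅ (by simp) (by simp)
      rw [empty, add_zero, ← Finset.insert_eq] at h
      exact ne_top_of_le_ne_top (ENNReal.add_ne_top.2 ⟨(single g).ne, ih⟩) h
  refine ⟨fun A => ENNReal.toReal_nonneg, fun A B hAB => ENNReal.toReal_mono (fin B) (mono A B hAB),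
    fun A B C hA hB => ?_, fun A g => by simp only [inv], by simp only [empty]; rfl⟩
  have := ENNReal.toReal_mono (ENNReal.add_ne_top.2 ⟨fin A, fin B⟩) (sub A B C hA hB)
  rwa [ENNReal.toReal_add (fin _) (fin _), ENNReal.toReal_add (fin _) (fin _)] at this

lemma pow_eq_iff {X : Type*} {r : ℕ} (T : FG r → X → X) (α : X → ℕ) (n : ℕ) (x y : X) :
    pow T α n x = pow T α n y ↔ ∀ g ∈ ballF r n, α (T g x) = α (T g y) := by
  unfold pow
  rw [powS_eq_iff]
  simp [ballF]

lemma FFc_eq {r : ℕ} {X : Type*} (m : MeasurableSpace X) [mX : MeasurableSpace X] (μ : Measure X)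
    (T : FG r → X → X)
    (hTmul : ∀ g h : FG r, T (g * h) = T g ∘ T h) (α : X → ℕ) (n : ℕ) :
    FFc (mX := mX) T μ m (pow T α n) =
      absF (fun A => (entS (mX := mX) T μ m α A).toReal) (ballF r n) := by
  unfold FFc absF entS
  congr 2
  · congr 1
    refine HpartC_congr μ m (fun x y => ?_)
    rw [pow_eq_iff, powS_eq_iff]
    rfl
  · funext i
    congr 1
    refine HpartC_congr μ m (fun x y => ?_)
    rw [powS_eq_iff]
    simp only [pjoin, pull, Prod.mk.injEq, pow_eq_iff, Finset.mem_coe, Finset.mem_union, mem_rt]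
    constructor
    · rintro ⟨h1, h2⟩ g (hg | ⟨a, ha, rfl⟩)
      · exact h1 g hg
      · rw [hTmul]; exact h2 a ha
    · intro h
      refine ⟨fun g hg => h g (Or.inl hg), fun g hg => ?_⟩
      have := h _ (Or.inr ⟨g, hg, rfl⟩)
      rwa [hTmul] at this

lemma FstarC_eq {r : ℕ} {X : Type*} (m : MeasurableSpace X) [mX : MeasurableSpace X] (μ : Measure X)
    (T : FG r → X → X)
    (hTmul : ∀ g h : FG r, T (g * h) = T g ∘ T h) (α : X → ℕ) (n : ℕ) :
    FstarC (mX := mX) T μ m (pow T α n) =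
      absFs (fun A => (entS (mX := mX) T μ m α A).toReal) (ballF r n) := by
  unfold FstarC absFs entS hrateC
  congr 2
  · congr 1
    refine HpartC_congr μ m (fun x y => ?_)
    rw [pow_eq_iff, powS_eq_iff]
    rfl
  · funext i
    congr 1
    funext k
    congr 2
    refine HpartC_congr μ m (fun x y => ?_)
    rw [powS_eq_iff, funext_iff]
    simp only [pow_eq_iff, Finset.mem_coe, mem_seg]
    constructor
    · rintro h _ ⟨j, hj, a, ha, rfl⟩
      rw [hTmul]
      exact h ⟨j, by omega⟩ a ha
    · intro h j g hg
      have := h _ ⟨j, by omega, g, hg, rfl⟩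
      rwa [hTmul] at this

end Final

/-- `f_*(T,α|β^G) = f(T,α|β^G)` for finite-entropy `α, β` with
`β^G ⊆ α^G`. -/
theorem stmt_15 {r : ℕ} (hr : 1 ≤ r) {X : Type*} [MeasurableSpace X] [StandardBorelSpace X]
    (μ : Measure X) [IsProbabilityMeasure μ]
    (T : FG r → X → X) (hT1 : T 1 = id)
    (hTmul : ∀ g h : FG r, T (g * h) = T g ∘ T h)
    (hTmp : ∀ g : FG r, MeasurePreserving (T g) μ μ)
    (α β : X → ℕ) (hαm : Measurable α) (hβm : Measurable β)
    (hHα : Hpart μ α < ⊤) (hHβ : Hpart μ β < ⊤)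
    (hsub : sAlgG T β ≤ sAlgG T α) :
    fstarC T μ (sAlgG T β) α = littleFc T μ (sAlgG T β) α := by
  have hm : sAlgG T β ≤ ‹MeasurableSpace X› := sAlgG_le T (fun g => (hTmp g).measurable) hβm
  have hE := entLike_entS (m := sAlgG T β) μ T hT1 hTmul hTmp α hαm hHα hm
    (comap_sAlgG T hTmul β)
  unfold fstarC littleFc
  simp_rw [FFc_eq (sAlgG T β) μ T hTmul α, FstarC_eq (sAlgG T β) μ T hTmul α]
  exact hE.main hr

end

end Bowen
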